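/- There exists a set X of 11 distinct points of the projective plane P^2 over k with generic Hilbert function such that H_{2X}(t) = m(t) for all t ≥ 0, where m(t) = binom(t+2,2) for 0 ≤ t ≤ 5, m(6) = 26, m(7) = 31, m(8) = 32, and m(t) = 33 for all t ≥ 9. (Such a set is given by the configuration C_{5,1}: remove 4 of the 5 intersection points lying on one fixed line from the 15 pairwise intersection points of 6 general lines in P^2.) -/

import Mathlib

open MvPolynomial

/-- The vanishing (prime) ideal of a point of ℙ²: the ideal generated by the
linear forms vanishing at the point. -/
noncomputable def pointIdeal (k : Type) [Field k] (P : Projectivization k (Fin 3 → k)) :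
    Ideal (MvPolynomial (Fin 3) k) :=
  Ideal.span {f : MvPolynomial (Fin 3) k | f.IsHomogeneous 1 ∧ eval P.rep f = 0}

/-- The Hilbert function of R/I: H(t) = dim_k R_t − dim_k I_t. -/
noncomputable def hilbertFunction (k : Type) [Field k]
    (I : Ideal (MvPolynomial (Fin 3) k)) (t : ℕ) : ℕ :=
  Module.finrank k ↥(homogeneousSubmodule (Fin 3) k t) -
    Module.finrank k ↥(Submodule.restrictScalars k I ⊓ homogeneousSubmodule (Fin 3) k t)

/-- The defining ideal `I_X` of a finite set of points. -/
noncomputable def idealOfPoints (k : Type) [Field k] {s : ℕ}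
    (P : Fin s → Projectivization k (Fin 3 → k)) : Ideal (MvPolynomial (Fin 3) k) :=
  ⨅ i, pointIdeal k (P i)

/-- The defining ideal `I_{2X}` of the double point scheme supported on a finite set of points. -/
noncomputable def doubleIdealOfPoints (k : Type) [Field k] {s : ℕ}
    (P : Fin s → Projectivization k (Fin 3 → k)) : Ideal (MvPolynomial (Fin 3) k) :=
  ⨅ i, (pointIdeal k (P i)) ^ 2

/-- `X` has generic Hilbert function: `H_X(t) = min {s, binom(t+2,2)}` for all `t`. -/
def HasGenericHilbertFunction (k : Type) [Field k] {s : ℕ}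
    (P : Fin s → Projectivization k (Fin 3 → k)) : Prop :=
  ∀ t : ℕ, hilbertFunction k (idealOfPoints k P) t = min s (Nat.choose (t + 2) 2)

section Preliminaries

variable {k : Type} [Field k]

theorem finrank_homogeneousSubmodule_fin_three (t : ℕ) :
    Module.finrank k (homogeneousSubmodule (Fin 3) k t) = (t + 2).choose 2 := by
  have hset : {d : Fin 3 →₀ ℕ | d.degree = t} =
      ((Finset.univ : Finset (Fin 3)).finsuppAntidiag t : Set (Fin 3 →₀ ℕ)) := by
    ext d
    simp [Finsupp.degree_eq_sum]
  rw [homogeneousSubmodule_eq_finsupp_supported, hset]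
  refine (AddMonoidAlgebra.supportedEquivFinsupp (R := k) (S := k) _).finrank_eq.trans ?_
  rw [Module.finrank_finsupp_self]
  refine (Fintype.card_coe _).trans ?_
  rw [Finset.card_finsuppAntidiag_nat_eq_choose,
    Finset.card_univ, Fintype.card_fin, show 3 + t - 1 = t + 2 by omega,
    ← Nat.choose_symm_add]

instance finiteDimensional_homogeneousSubmodule (t : ℕ) :
    FiniteDimensional k (homogeneousSubmodule (Fin 3) k t) :=
  Module.Finite.iff_fg.mpr (homogeneousSubmodule_fg (Fin 3) k t)

theorem hilbertFunction_eq {I : Ideal (MvPolynomial (Fin 3) k)} {t r : ℕ}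
    (h : Module.finrank k ↥(Submodule.restrictScalars k I ⊓ homogeneousSubmodule (Fin 3) k t) + r =
      (t + 2).choose 2) :
    hilbertFunction k I t = r := by
  rw [hilbertFunction, finrank_homogeneousSubmodule_fin_three]
  omega

theorem eval_smul_of_isHomogeneous {σ : Type*} {f : MvPolynomial σ k} {t : ℕ}
    (hf : f.IsHomogeneous t) (c : k) (v : σ → k) : eval (c • v) f = c ^ t * eval v f := by
  rw [eval_eq, eval_eq, Finset.mul_sum]
  refine Finset.sum_congr rfl fun d hd => ?_
  have hd' : ∑ i ∈ d.support, d i = t := (hf.degree_eq_sum_deg_support hd).symm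
  simp only [Pi.smul_apply, smul_eq_mul, mul_pow, Finset.prod_mul_distrib]
  rw [Finset.prod_pow_eq_pow_sum, hd']
  ring

theorem exists_isHomogeneous_right_factor {σ : Type*} {f l g : MvPolynomial σ k} {d e : ℕ}
    (hf : f.IsHomogeneous (d + e)) (hl : l.IsHomogeneous d) (h : f = l * g) :
    ∃ g', g'.IsHomogeneous e ∧ f = l * g' := by
  refine ⟨homogeneousComponent e g, homogeneousComponent_isHomogeneous _ _, ?_⟩
  let _ := MvPolynomial.gradedAlgebra (σ := σ) (R := k)
  have h1 := DirectSum.coe_decompose_mul_of_left_mem_of_le (homogeneousSubmodule σ k) (b := g)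
    (n := d + e) ((mem_homogeneousSubmodule _ _).mpr hl) (Nat.le_add_right d e)
  rw [← h, DirectSum.decompose_of_mem_same _ ((mem_homogeneousSubmodule _ _).mpr hf),
    Nat.add_sub_cancel_left] at h1
  exact h1.trans (congrArg (l * ·) (decomposition.decompose'_apply g e))

end Preliminaries

section PointIdeals

variable {k : Type} [Field k] {v : Fin 3 → k}

theorem ne_zero_of_apply_two_eq_one (h : v 2 = 1) : v ≠ 0 := by
  rintro rfl
  simp at h

theorem X_sub_mem_pointIdeal (hv : v 2 = 1) (i : Fin 3) :
    X i - C (v i) * X 2 ∈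
      pointIdeal k (Projectivization.mk k v (ne_zero_of_apply_two_eq_one hv)) := by
  obtain ⟨a, ha⟩ := Projectivization.exists_smul_eq_mk_rep k v (ne_zero_of_apply_two_eq_one hv)
  refine Ideal.subset_span ⟨(isHomogeneous_X k i).sub (isHomogeneous_C_mul_X _ _), ?_⟩
  rw [← ha]
  simp [Units.smul_def, hv]
  ring

theorem eval_eq_zero_of_mem_pointIdeal (hv : v ≠ 0) {f : MvPolynomial (Fin 3) k}
    (hf : f ∈ pointIdeal k (Projectivization.mk k v hv)) : eval v f = 0 := by
  suffices pointIdeal k (Projectivization.mk k v hv) ≤ RingHom.ker (eval v) from this hf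
  refine Ideal.span_le.mpr ?_
  rintro l ⟨hl, h0⟩
  obtain ⟨a, ha⟩ := Projectivization.exists_smul_eq_mk_rep k v hv
  rw [← ha, Units.smul_def, eval_smul_of_isHomogeneous hl] at h0
  simpa using h0

/-- First-order Taylor expansion at `v`, modulo the square of the ideal of `v`. -/
theorem taylor_mem_pointIdeal_sq (hv : v 2 = 1) (f : MvPolynomial (Fin 3) k) :
    f - aeval (fun i => C (v i) * X 2) f
      - (aeval (fun i => C (v i) * X 2) (pderiv 0 f) * (X 0 - C (v 0) * X 2)
        + aeval (fun i => C (v i) * X 2) (pderiv 1 f) * (X 1 - C (v 1) * X 2)) ∈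
      pointIdeal k (Projectivization.mk k v (ne_zero_of_apply_two_eq_one hv)) ^ 2 := by
  set I := pointIdeal k (Projectivization.mk k v (ne_zero_of_apply_two_eq_one hv))
  have hW : ∀ i j, (X i - C (v i) * X 2) * (X j - C (v j) * X 2) ∈ I ^ 2 := fun i j => by
    rw [pow_two]
    exact Ideal.mul_mem_mul (X_sub_mem_pointIdeal hv i) (X_sub_mem_pointIdeal hv j)
  induction f using MvPolynomial.induction_on with
  | C a => simp
  | add p q hp hq =>
    convert add_mem hp hq using 1
    simp only [map_add]
    ring
  | mul_X p n hp =>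
    set τ : MvPolynomial (Fin 3) k →ₐ[k] MvPolynomial (Fin 3) k :=
      aeval (fun i => C (v i) * X 2)
    have h1 := (I ^ 2).mul_mem_left (X n) hp
    have h2 := add_mem ((I ^ 2).mul_mem_left (τ (pderiv 0 p)) (hW 0 n))
      ((I ^ 2).mul_mem_left (τ (pderiv 1 p)) (hW 1 n))
    convert add_mem h1 h2 using 1
    have hτ : τ (X n) = C (v n) * X 2 := aeval_X _ _
    simp only [Derivation.leibniz, smul_eq_mul, map_add, map_mul, hτ, pderiv_X]
    fin_cases n <;> simp [hv] <;> ring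

theorem aeval_C_mul_X_eq_zero [Infinite k] {f : MvPolynomial (Fin 3) k} {t : ℕ}
    (hf : f.IsHomogeneous t) (h : eval v f = 0) :
    aeval (fun i => C (v i) * X 2 : Fin 3 → MvPolynomial (Fin 3) k) f = 0 := by
  refine MvPolynomial.funext fun w => ?_
  have : eval w (aeval (fun i => C (v i) * X 2 : Fin 3 → MvPolynomial (Fin 3) k) f)
      = eval (w 2 • v) f := by
    rw [← coe_aeval_eq_eval, ← coe_aeval_eq_eval, RingHom.coe_coe, RingHom.coe_coe,
      comp_aeval_apply]
    congr 2
    ext i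
    simp [mul_comm]
  rw [this, eval_smul_of_isHomogeneous hf, h, mul_zero, map_zero]

theorem mem_pointIdeal_iff [Infinite k] (hv : v 2 = 1) {f : MvPolynomial (Fin 3) k} {t : ℕ}
    (hf : f.IsHomogeneous t) :
    f ∈ pointIdeal k (Projectivization.mk k v (ne_zero_of_apply_two_eq_one hv)) ↔
      eval v f = 0 := by
  refine ⟨eval_eq_zero_of_mem_pointIdeal _, fun h => ?_⟩
  have h1 := Ideal.pow_le_self two_ne_zero (taylor_mem_pointIdeal_sq hv f)
  rw [aeval_C_mul_X_eq_zero hf h, sub_zero] at h1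
  exact (Submodule.sub_mem_iff_left _ (add_mem
    (Ideal.mul_mem_left _ _ (X_sub_mem_pointIdeal hv 0))
    (Ideal.mul_mem_left _ _ (X_sub_mem_pointIdeal hv 1)))).mp h1

/-- The first-order conditions, in the chart `X 2 ≠ 0`, for `f` to be singular at `v`. -/
def IsSingularAt (v : Fin 3 → k) (f : MvPolynomial (Fin 3) k) : Prop :=
  eval v f = 0 ∧ eval v (pderiv 0 f) = 0 ∧ eval v (pderiv 1 f) = 0

theorem IsSingularAt.mul_left {g : MvPolynomial (Fin 3) k} (h : IsSingularAt v g)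
    (f : MvPolynomial (Fin 3) k) : IsSingularAt v (f * g) := by
  obtain ⟨h0, h1, h2⟩ := h
  simp [IsSingularAt, h0, h1, h2]

theorem IsSingularAt.mul_right {f : MvPolynomial (Fin 3) k} (h : IsSingularAt v f)
    (g : MvPolynomial (Fin 3) k) : IsSingularAt v (f * g) :=
  mul_comm g f ▸ h.mul_left g

theorem isSingularAt_mul {f g : MvPolynomial (Fin 3) k} (hf : eval v f = 0) (hg : eval v g = 0) :
    IsSingularAt v (f * g) := by
  simp [IsSingularAt, hf, hg]

theorem IsSingularAt.of_mul_left {f g : MvPolynomial (Fin 3) k} (h : IsSingularAt v (f * g))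
    (hf : eval v f ≠ 0) : IsSingularAt v g := by
  obtain ⟨h0, h1, h2⟩ := h
  have hg : eval v g = 0 := by simpa [hf] using h0
  refine ⟨hg, ?_, ?_⟩
  · simpa [hg, hf] using h1
  · simpa [hg, hf] using h2

theorem mem_pointIdeal_sq_iff [Infinite k] (hv : v 2 = 1) {f : MvPolynomial (Fin 3) k} {t : ℕ}
    (hf : f.IsHomogeneous t) :
    f ∈ pointIdeal k (Projectivization.mk k v (ne_zero_of_apply_two_eq_one hv)) ^ 2 ↔
      IsSingularAt v f := by
  constructor
  · intro h
    rw [pow_two] at h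
    refine Submodule.mul_induction_on h (fun a ha b hb => isSingularAt_mul
      (eval_eq_zero_of_mem_pointIdeal _ ha) (eval_eq_zero_of_mem_pointIdeal _ hb)) ?_
    rintro a b ⟨ha0, ha1, ha2⟩ ⟨hb0, hb1, hb2⟩
    simp [IsSingularAt, *]
  · rintro ⟨h0, h1, h2⟩
    have h := taylor_mem_pointIdeal_sq hv f
    rwa [aeval_C_mul_X_eq_zero hf h0, aeval_C_mul_X_eq_zero hf.pderiv h1,
      aeval_C_mul_X_eq_zero hf.pderiv h2, zero_mul, zero_mul, add_zero, sub_zero, sub_zero] at h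

end PointIdeals

section Interpolation

variable {k : Type} [Field k] {n : ℕ}

/-- The forms of degree `t` vanishing at all the points `v i` and singular at those with `i ∈ A`. -/
noncomputable def fatPointForms (v : Fin n → Fin 3 → k) (A : Finset (Fin n)) (t : ℕ) :
    Submodule k (MvPolynomial (Fin 3) k) where
  carrier := {f | f.IsHomogeneous t ∧ (∀ i, eval (v i) f = 0) ∧ ∀ i ∈ A, IsSingularAt (v i) f}
  zero_mem' := ⟨isHomogeneous_zero _ _ _, by simp, by simp [IsSingularAt]⟩
  add_mem' := by
    rintro f g ⟨hf, hf0, hf1⟩ ⟨hg, hg0, hg1⟩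
    refine ⟨hf.add hg, fun i => by simp [hf0 i, hg0 i], fun i hi => ?_⟩
    obtain ⟨h0, h1, h2⟩ := hf1 i hi
    obtain ⟨h0', h1', h2'⟩ := hg1 i hi
    simp [IsSingularAt, *]
  smul_mem' := by
    rintro c f ⟨hf, hf0, hf1⟩
    rw [smul_eq_C_mul]
    exact ⟨hf.C_mul c, fun i => by simp [hf0 i], fun i hi => (hf1 i hi).mul_left _⟩

theorem mem_fatPointForms {v : Fin n → Fin 3 → k} {A : Finset (Fin n)} {t : ℕ}
    {f : MvPolynomial (Fin 3) k} :
    f ∈ fatPointForms v A t ↔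
      f.IsHomogeneous t ∧ (∀ i, eval (v i) f = 0) ∧ ∀ i ∈ A, IsSingularAt (v i) f :=
  Iff.rfl

/-- The values at the points `v i` together with the two affine partial derivatives at those
with `i ∈ A`. -/
noncomputable def jetMap (v : Fin n → Fin 3 → k) (A : Finset (Fin n)) :
    MvPolynomial (Fin 3) k →ₗ[k] (Fin n → k) × (A → k) × (A → k) :=
  (LinearMap.pi fun i => (aeval (v i)).toLinearMap).prod
    ((LinearMap.pi fun i : A => (aeval (v i)).toLinearMap ∘ₗ (pderiv 0).toLinearMap).prod
      (LinearMap.pi fun i : A => (aeval (v i)).toLinearMap ∘ₗ (pderiv 1).toLinearMap))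

theorem jetMap_apply (v : Fin n → Fin 3 → k) (A : Finset (Fin n)) (f : MvPolynomial (Fin 3) k) :
    jetMap v A f = (fun i => eval (v i) f, fun i : A => eval (v i) (pderiv 0 f),
      fun i : A => eval (v i) (pderiv 1 f)) := by
  simp only [jetMap, ← coe_aeval_eq_eval]
  rfl

theorem fatPointForms_eq_inf_ker (v : Fin n → Fin 3 → k) (A : Finset (Fin n)) (t : ℕ) :
    fatPointForms v A t =
      homogeneousSubmodule (Fin 3) k t ⊓ LinearMap.ker (jetMap v A) := by
  ext f
  simp only [mem_fatPointForms, Submodule.mem_inf, mem_homogeneousSubmodule, LinearMap.mem_ker,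
    jetMap_apply, Prod.ext_iff, funext_iff, Prod.fst_zero, Prod.snd_zero, Pi.zero_apply,
    Subtype.forall, IsSingularAt]
  grind

theorem finrank_fatPointForms_of_forall_exists (v : Fin n → Fin 3 → k) (A : Finset (Fin n)) (t : ℕ)
    (h : ∀ (i : Fin n) (a b c : k), ∃ f : MvPolynomial (Fin 3) k, f.IsHomogeneous t ∧
      eval (v i) f = a ∧ (i ∈ A → eval (v i) (pderiv 0 f) = b ∧ eval (v i) (pderiv 1 f) = c) ∧
      ∀ j ≠ i, eval (v j) f = 0 ∧ (j ∈ A → IsSingularAt (v j) f)) :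
    Module.finrank k (fatPointForms v A t) + (n + 2 * A.card) = (t + 2).choose 2 := by
  set V := homogeneousSubmodule (Fin 3) k t
  set φ := (jetMap v A).domRestrict V
  have hsurj : Function.Surjective φ := by
    rintro ⟨x, y, z⟩
    choose f hf hx hyz h0 using fun i => h i (x i) (if hi : i ∈ A then y ⟨i, hi⟩ else 0)
      (if hi : i ∈ A then z ⟨i, hi⟩ else 0)
    refine ⟨⟨∑ i, f i, Submodule.sum_mem _ fun i _ => hf i⟩, (jetMap_apply v A (∑ i, f i)).trans <|
      Prod.ext (funext fun j => ?_) (Prod.ext (funext fun j => ?_) (funext fun j => ?_))⟩ <;>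
      simp only [map_sum]
    · rw [Finset.sum_eq_single_of_mem j (Finset.mem_univ _) fun i _ hij => (h0 i j hij.symm).1, hx]
    · rw [Finset.sum_eq_single_of_mem j.1 (Finset.mem_univ _)
        fun i _ hij => ((h0 i j hij.symm).2 j.2).2.1, (hyz j j.2).1, dif_pos j.2]
    · rw [Finset.sum_eq_single_of_mem j.1 (Finset.mem_univ _)
        fun i _ hij => ((h0 i j hij.symm).2 j.2).2.2, (hyz j j.2).2, dif_pos j.2]
  have h1 := φ.finrank_range_add_finrank_ker
  rw [LinearMap.range_eq_top.mpr hsurj, finrank_top, finrank_homogeneousSubmodule_fin_three] at h1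
  have h2 : (LinearMap.ker φ).map V.subtype = fatPointForms v A t := by
    rw [fatPointForms_eq_inf_ker, LinearMap.ker_domRestrict, Submodule.map_comap_subtype]
  have h3 := (Submodule.equivMapOfInjective V.subtype V.injective_subtype
    (LinearMap.ker φ)).finrank_eq
  rw [h2] at h3
  rw [← h1, ← h3]
  simp only [Module.finrank_prod, Module.finrank_fintype_fun_eq_card, Fintype.card_fin,
    Fintype.card_coe]
  ring

/-- A form not vanishing at `v` has a multiple with prescribed value and affine partial
derivatives at `v`. -/
theorem exists_mul_jet_eq {v : Fin 3 → k} (hv : v 2 = 1) {g : MvPolynomial (Fin 3) k}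
    (hg : eval v g ≠ 0) (e : ℕ) (a b c : k) :
    ∃ q : MvPolynomial (Fin 3) k, q.IsHomogeneous (e + 1) ∧ eval v (g * q) = a ∧
      eval v (pderiv 0 (g * q)) = b ∧ eval v (pderiv 1 (g * q)) = c := by
  generalize hG : eval v g = G at hg
  set α := a / G
  set β := (b - eval v (pderiv 0 g) * α) / G
  set γ := (c - eval v (pderiv 1 g) * α) / G
  have hl (i : Fin 3) : (X i - C (v i) * X 2 : MvPolynomial (Fin 3) k).IsHomogeneous 1 :=
    (isHomogeneous_X k i).sub (isHomogeneous_C_mul_X _ _)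
  refine ⟨X 2 ^ e * (C α * X 2 + (C β * (X 0 - C (v 0) * X 2) + C γ * (X 1 - C (v 1) * X 2))),
    (isHomogeneous_X_pow _ _).mul ((isHomogeneous_C_mul_X _ _).add
      (((hl 0).C_mul β).add ((hl 1).C_mul γ))), ?_, ?_, ?_⟩
  · simp [hv, α, hG]
    field_simp
  all_goals
    simp [hv, Derivation.leibniz_pow, pderiv_X, α, β, γ, hG]
    field_simp
    ring

end Interpolation

section TangentLines

variable {k : Type} [Field k]

/-- The intersection point of the tangent lines with parameters `a` and `b` to a fixed conic. -/
def node (a b : k) : Fin 3 → k := ![a + b, a * b, 1]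

theorem node_two (a b : k) : node a b 2 = 1 := rfl

theorem node_comm (a b : k) : node a b = node b a := by
  rw [node, node, add_comm, mul_comm]

/-- The equation of the tangent line with parameter `a`. -/
noncomputable def tangentLine (a : k) : MvPolynomial (Fin 3) k := X 1 - C a * X 0 + C (a ^ 2) * X 2

theorem isHomogeneous_tangentLine (a : k) : (tangentLine a).IsHomogeneous 1 :=
  ((isHomogeneous_X k 1).sub (isHomogeneous_C_mul_X _ _)).add (isHomogeneous_C_mul_X _ _)

theorem eval_node_tangentLine (a b c : k) :
    eval (node b c) (tangentLine a) = (a - b) * (a - c) := by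
  simp [tangentLine, node]
  ring

theorem tangentLine_ne_zero (a : k) : tangentLine a ≠ 0 := by
  intro h
  have := eval_node_tangentLine a (a - 1) (a - 1)
  rw [h, map_zero] at this
  simp at this

theorem eval_eq_zero_of_isSingularAt_tangentLine_mul {a b : k} {g : MvPolynomial (Fin 3) k}
    (h : IsSingularAt (node a b) (tangentLine a * g)) : eval (node a b) g = 0 := by
  have h2 := h.2.2
  rw [Derivation.leibniz, map_add, smul_eq_mul, smul_eq_mul, map_mul, map_mul,
    eval_node_tangentLine] at h2
  simpa [tangentLine, pderiv_X] using h2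

/-- Restriction of polynomials to the tangent line with parameter `a`, parametrized by
`b ↦ node a b`. -/
noncomputable def restrictLine (a : k) : MvPolynomial (Fin 3) k →ₐ[k] Polynomial k :=
  aeval ![Polynomial.C a + Polynomial.X, Polynomial.C a * Polynomial.X, 1]

theorem eval_restrictLine (a b : k) (f : MvPolynomial (Fin 3) k) :
    (restrictLine a f).eval b = eval (node a b) f := by
  rw [← Polynomial.coe_aeval_eq_eval, ← coe_aeval_eq_eval, RingHom.coe_coe, restrictLine,
    comp_aeval_apply]
  congr 2
  ext i
  fin_cases i <;> simp [node]

theorem restrictLine_tangentLine_ne_zero [Infinite k] {a b : k} (h : a ≠ b) :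
    restrictLine a (tangentLine b) ≠ 0 := by
  intro h0
  obtain ⟨c, hc⟩ := exists_ne b
  have := eval_restrictLine a c (tangentLine b)
  rw [h0, Polynomial.eval_zero, eval_node_tangentLine, eq_comm, mul_eq_zero, sub_eq_zero,
    sub_eq_zero] at this
  exact this.elim h.symm hc.symm

theorem natDegree_restrictLine_le (a : k) {f : MvPolynomial (Fin 3) k} {t : ℕ}
    (hf : f.IsHomogeneous t) : (restrictLine a f).natDegree ≤ t := by
  have := aeval_natDegree_le (n := 1) f hf.totalDegree_le
    ![Polynomial.C a + Polynomial.X, Polynomial.C a * Polynomial.X, 1] (by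
      intro i
      fin_cases i
      · exact (Polynomial.natDegree_C_add.trans Polynomial.natDegree_X).le
      · exact (Polynomial.natDegree_C_mul_le _ _).trans Polynomial.natDegree_X_le
      · simp)
  simpa only [restrictLine, mul_one] using this

theorem X_sub_C_dvd_restrictLine {a b : k} {f : MvPolynomial (Fin 3) k}
    (hf : eval (node a b) f = 0) : Polynomial.X - Polynomial.C b ∣ restrictLine a f := by
  rwa [Polynomial.dvd_iff_isRoot, Polynomial.IsRoot, eval_restrictLine]

theorem X_sub_C_sq_dvd_restrictLine [Infinite k] {a b : k} {t : ℕ} {f : MvPolynomial (Fin 3) k}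
    (hf : f.IsHomogeneous t) (h : IsSingularAt (node a b) f) :
    (Polynomial.X - Polynomial.C b) ^ 2 ∣ restrictLine a f := by
  rw [← Ideal.mem_span_singleton, ← Ideal.span_singleton_pow]
  have h' := Ideal.mem_map_of_mem (restrictLine a) ((mem_pointIdeal_sq_iff (node_two a b) hf).mpr h)
  rw [Ideal.map_pow] at h'
  refine Ideal.pow_right_mono (Ideal.map_le_iff_le_comap.mpr fun g hg => ?_) 2 h'
  rw [Ideal.mem_comap, Ideal.mem_span_singleton]
  exact X_sub_C_dvd_restrictLine (eval_eq_zero_of_mem_pointIdeal _ hg)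

theorem restrictLine_eq_zero {a : k} {m t : ℕ} {B : Finset k} {f : MvPolynomial (Fin 3) k}
    (hf : f.IsHomogeneous t) (ht : t < B.card * m)
    (hB : ∀ b ∈ B, (Polynomial.X - Polynomial.C b) ^ m ∣ restrictLine a f) :
    restrictLine a f = 0 := by
  refine Polynomial.eq_zero_of_dvd_of_natDegree_lt
    (Finset.prod_dvd_of_coprime (fun b _ c _ hbc => ?_) hB) ?_
  · exact (Polynomial.pairwise_coprime_X_sub_C Function.injective_id hbc).pow
  · rw [Polynomial.natDegree_prod_of_monic _ _ fun b _ => (Polynomial.monic_X_sub_C b).pow m]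
    simp only [Polynomial.natDegree_pow, Polynomial.natDegree_X_sub_C, Finset.sum_const, smul_eq_mul,
      mul_one]
    exact (natDegree_restrictLine_le a hf).trans_lt ht

theorem tangentLine_dvd [Infinite k] {a : k} {t : ℕ} {f : MvPolynomial (Fin 3) k}
    (hf : f.IsHomogeneous t) (h : restrictLine a f = 0) : tangentLine a ∣ f := by
  set σ : MvPolynomial (Fin 3) k →ₐ[k] MvPolynomial (Fin 3) k :=
    aeval ![X 0, X 1 - tangentLine a, X 2]
  have hσ : X 2 * σ f = 0 := by
    refine MvPolynomial.funext fun w => ?_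
    rw [map_mul, eval_X, map_zero]
    by_cases hw : w 2 = 0
    · rw [hw, zero_mul]
    have h1 : eval w (σ f) = eval (w 2 • node a (w 0 / w 2 - a)) f := by
      rw [← coe_aeval_eq_eval, ← coe_aeval_eq_eval, RingHom.coe_coe, RingHom.coe_coe,
        comp_aeval_apply]
      congr 2
      ext i
      fin_cases i <;> simp [node, tangentLine] <;> field_simp
      ring
    rw [h1, eval_smul_of_isHomogeneous hf, ← eval_restrictLine, h]
    simp
  have hσ0 : σ f = 0 := (mul_eq_zero.mp hσ).resolve_left (X_ne_zero 2)
  have hmod : f - σ f ∈ Ideal.span {tangentLine a} := by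
    rw [← Ideal.Quotient.mk_eq_mk_iff_sub_mem]
    have : (Ideal.Quotient.mkₐ k (Ideal.span {tangentLine a})).comp σ =
        Ideal.Quotient.mkₐ k (Ideal.span {tangentLine a}) := by
      refine MvPolynomial.algHom_ext fun i => ?_
      have h0 : Ideal.Quotient.mk (Ideal.span {tangentLine a}) (tangentLine a) = 0 :=
        Ideal.Quotient.eq_zero_iff_mem.mpr (Ideal.mem_span_singleton_self _)
      fin_cases i <;> simp [σ, h0]
    exact (DFunLike.congr_fun this f).symm
  rwa [hσ0, sub_zero, Ideal.mem_span_singleton] at hmod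

theorem exists_eq_tangentLine_mul [Infinite k] {a : k} {t : ℕ} {f : MvPolynomial (Fin 3) k}
    (hf : f.IsHomogeneous t) (h : restrictLine a f = 0) :
    ∃ g, g.IsHomogeneous (t - 1) ∧ f = tangentLine a * g ∧ (t = 0 → f = 0) := by
  obtain ⟨g, hg⟩ := tangentLine_dvd hf h
  cases t with
  | succ t =>
    obtain ⟨g', hg', h'⟩ :=
      exists_isHomogeneous_right_factor (add_comm t 1 ▸ hf) (isHomogeneous_tangentLine a) hg
    exact ⟨g', hg', h', by simp⟩
  | zero =>
    refine ⟨0, isHomogeneous_zero _ _ _, ?_⟩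
    rw [← mem_homogeneousSubmodule, homogeneousSubmodule_zero, Submodule.mem_one] at hf
    obtain ⟨c, rfl⟩ := hf
    have : c = 0 := by simpa using h
    simp [this]

theorem exists_eq_prod_tangentLine_mul [Infinite k] (A : Finset k) {t : ℕ}
    {f : MvPolynomial (Fin 3) k} (hf : f.IsHomogeneous t) (h : ∀ a ∈ A, restrictLine a f = 0) :
    ∃ g, g.IsHomogeneous (t - A.card) ∧ f = (∏ a ∈ A, tangentLine a) * g ∧
      (t < A.card → f = 0) := by
  induction A using Finset.cons_induction generalizing t f with
  | empty => exact ⟨f, by simpa using hf, by simp⟩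
  | cons a A ha ih =>
    obtain ⟨g, hg, rfl, ht0⟩ := exists_eq_tangentLine_mul hf (h a (Finset.mem_cons_self a A))
    obtain ⟨g', hg', rfl, h0⟩ := ih hg fun b hb => by
      have hb' := h b (Finset.mem_cons_of_mem hb)
      rw [map_mul] at hb'
      exact (mul_eq_zero.mp hb').resolve_left
        (restrictLine_tangentLine_ne_zero fun hba => ha (hba ▸ hb))
    refine ⟨g', by rwa [Finset.card_cons, add_comm, ← Nat.sub_sub],
      by rw [Finset.prod_cons, mul_assoc], fun ht => ?_⟩
    rw [Finset.card_cons] at ht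
    rcases Nat.eq_zero_or_pos t with rfl | htpos
    · exact ht0 rfl
    · rw [h0 (by omega), mul_zero]

end TangentLines

section Nodes

variable {k : Type} [Field k] {n : ℕ}

/-- The nodes with parameters `p i` and `q i`. -/
def nodes (k : Type) [Field k] (p q : Fin n → ℕ) (i : Fin n) : Fin 3 → k := node (p i : k) (q i)

/-- The product of the tangent lines with parameters in `S`. -/
noncomputable def lineProd (k : Type) [Field k] (S : Finset ℕ) : MvPolynomial (Fin 3) k :=
  ∏ c ∈ S, tangentLine (c : k)

theorem isHomogeneous_lineProd (S : Finset ℕ) : (lineProd k S).IsHomogeneous S.card := by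
  rw [Finset.card_eq_sum_ones]
  exact IsHomogeneous.prod _ _ _ fun c _ => isHomogeneous_tangentLine _

theorem lineProd_ne_zero (S : Finset ℕ) : lineProd k S ≠ 0 :=
  Finset.prod_ne_zero_iff.mpr fun _ _ => tangentLine_ne_zero _

theorem eval_lineProd_eq_zero {p q : Fin n → ℕ} {i : Fin n} {S : Finset ℕ}
    (h : p i ∈ S ∨ q i ∈ S) : eval (nodes k p q i) (lineProd k S) = 0 := by
  rw [lineProd, map_prod]
  rcases h with h | h <;>
    exact Finset.prod_eq_zero h (by simp [nodes, eval_node_tangentLine])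

theorem eval_lineProd_ne_zero [CharZero k] {p q : Fin n → ℕ} {i : Fin n} {S : Finset ℕ}
    (hp : p i ∉ S) (hq : q i ∉ S) : eval (nodes k p q i) (lineProd k S) ≠ 0 := by
  rw [lineProd, map_prod, Finset.prod_ne_zero_iff]
  intro c hc
  rw [nodes, eval_node_tangentLine]
  refine mul_ne_zero (sub_ne_zero.mpr ?_) (sub_ne_zero.mpr ?_) <;> rw [Ne, Nat.cast_inj] <;>
    rintro rfl
  exacts [hp hc, hq hc]

/-- The nodes impose independent conditions as soon as there are suitable separating products of
tangent lines. -/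
theorem finrank_fatPointForms_nodes [CharZero k] {p q : Fin n → ℕ} {A : Finset (Fin n)} {t : ℕ}
    (S T : Fin n → Finset ℕ)
    (hST : ∀ i, (p i ∉ S i ∧ q i ∉ S i) ∧ p i ∉ T i ∧ q i ∉ T i)
    (hS : ∀ i j, j ≠ i → p j ∈ S i ∨ q j ∈ S i)
    (hT : ∀ i, ∀ j ∈ A, j ≠ i → p j ∈ T i ∨ q j ∈ T i)
    (hcard : ∀ i, (S i).card + (T i).card ≤ t)
    (hcard' : ∀ i ∈ A, (S i).card + (T i).card < t) :
    Module.finrank k (fatPointForms (nodes k p q) A t) + (n + 2 * A.card) = (t + 2).choose 2 := by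
  refine finrank_fatPointForms_of_forall_exists _ _ _ fun i a b c => ?_
  set v := nodes k p q
  set g := lineProd k (S i) * lineProd k (T i)
  have hg : g.IsHomogeneous ((S i).card + (T i).card) :=
    (isHomogeneous_lineProd _).mul (isHomogeneous_lineProd _)
  have hgi : eval (v i) g ≠ 0 := by
    obtain ⟨⟨h1, h2⟩, h3, h4⟩ := hST i
    rw [map_mul]
    exact mul_ne_zero (eval_lineProd_ne_zero h1 h2) (eval_lineProd_ne_zero h3 h4)
  have hgj (r : MvPolynomial (Fin 3) k) (j : Fin n) (hj : j ≠ i) :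
      eval (v j) (g * r) = 0 ∧ (j ∈ A → IsSingularAt (v j) (g * r)) := by
    have h0 := eval_lineProd_eq_zero (k := k) (hS i j hj)
    refine ⟨by rw [map_mul, map_mul, h0, zero_mul, zero_mul], fun hjA => ?_⟩
    exact (isSingularAt_mul h0 (eval_lineProd_eq_zero (hT i j hjA hj))).mul_right r
  by_cases hi : i ∈ A
  · obtain ⟨e, he⟩ := Nat.exists_eq_add_of_lt (hcard' i hi)
    obtain ⟨r, hr, h⟩ := exists_mul_jet_eq (node_two _ _) hgi e a b c
    exact ⟨g * r, he ▸ hg.mul hr, h.1, fun _ => h.2, hgj r⟩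
  · obtain ⟨e, he⟩ := Nat.exists_eq_add_of_le (hcard i)
    refine ⟨g * (C (a / eval (v i) g) * X 2 ^ e), he ▸ hg.mul (isHomogeneous_C_mul_X_pow _ _ _), ?_,
      fun h => absurd h hi, hgj _⟩
    have : v i 2 = 1 := node_two _ _
    simp [this, mul_div_cancel₀ _ hgi]

theorem finrank_eq_of_forall_mem_iff {V W : Submodule k (MvPolynomial (Fin 3) k)}
    {l : MvPolynomial (Fin 3) k} (hl : l ≠ 0) (h : ∀ f, f ∈ W ↔ ∃ g ∈ V, l * g = f) :
    Module.finrank k W = Module.finrank k V := by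
  have hW : W = V.map (LinearMap.mulLeft k l) := Submodule.ext h
  rw [hW]
  exact (Submodule.equivMapOfInjective _ (mul_right_injective₀ hl) V).finrank_eq.symm

theorem restrictLine_eq_zero_of_eval_eq_zero [CharZero k] {p q : Fin n → ℕ} {a t : ℕ}
    {B : Finset ℕ} (hB : ∀ b ∈ B, ∃ i, p i = a ∧ q i = b ∨ p i = b ∧ q i = a)
    {f : MvPolynomial (Fin 3) k} (hf : f.IsHomogeneous t) (ht : t < B.card)
    (h : ∀ i, eval (nodes k p q i) f = 0) : restrictLine (a : k) f = 0 := by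
  refine restrictLine_eq_zero (m := 1) (B := B.map Nat.castEmbedding) hf (by simpa) ?_
  simp only [Finset.mem_map, Nat.castEmbedding_apply, pow_one]
  rintro _ ⟨b, hb, rfl⟩
  apply X_sub_C_dvd_restrictLine
  obtain ⟨i, ⟨rfl, rfl⟩ | ⟨rfl, rfl⟩⟩ := hB b hb
  exacts [h i, node_comm (k := k) _ _ ▸ h i]

theorem restrictLine_eq_zero_of_isSingularAt [CharZero k] {p q : Fin n → ℕ} {a t : ℕ}
    {B : Finset ℕ} (hB : ∀ b ∈ B, ∃ i, p i = a ∧ q i = b ∨ p i = b ∧ q i = a)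
    {f : MvPolynomial (Fin 3) k} (hf : f.IsHomogeneous t) (ht : t < B.card * 2)
    (h : ∀ i, IsSingularAt (nodes k p q i) f) : restrictLine (a : k) f = 0 := by
  refine restrictLine_eq_zero (m := 2) (B := B.map Nat.castEmbedding) hf (by simpa) ?_
  simp only [Finset.mem_map, Nat.castEmbedding_apply]
  rintro _ ⟨b, hb, rfl⟩
  apply X_sub_C_sq_dvd_restrictLine hf
  obtain ⟨i, ⟨rfl, rfl⟩ | ⟨rfl, rfl⟩⟩ := hB b hb
  exacts [h i, node_comm (k := k) _ _ ▸ h i]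

theorem exists_eq_lineProd_mul [CharZero k] (S : Finset ℕ) {t : ℕ} {f : MvPolynomial (Fin 3) k}
    (hf : f.IsHomogeneous t) (h : ∀ a ∈ S, restrictLine (a : k) f = 0) :
    ∃ g, g.IsHomogeneous (t - S.card) ∧ f = lineProd k S * g ∧ (t < S.card → f = 0) := by
  have := exists_eq_prod_tangentLine_mul (S.map Nat.castEmbedding) hf (by simpa using h)
  rwa [Finset.prod_map, Finset.card_map] at this

/-- The projective points underlying the nodes. -/
noncomputable def nodePoints (k : Type) [Field k] (p q : Fin n → ℕ) (i : Fin n) :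
    Projectivization k (Fin 3 → k) :=
  Projectivization.mk k (nodes k p q i) (ne_zero_of_apply_two_eq_one (node_two _ _))

theorem nodePoints_injective [CharZero k] {p q : Fin n → ℕ}
    (h : ∀ i j, p i + q i = p j + q j → p i * q i = p j * q j → i = j) :
    Function.Injective (nodePoints k p q) := by
  intro i j hij
  obtain ⟨a, ha⟩ := (Projectivization.mk_eq_mk_iff' k _ _ _ _).mp hij
  have h2 := congrFun ha 2
  rw [Pi.smul_apply, nodes, nodes, node_two, node_two, smul_eq_mul, mul_one] at h2
  rw [h2, one_smul] at ha
  have h0 := congrFun ha 0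
  have h1 := congrFun ha 1
  simp only [nodes, node, Matrix.cons_val] at h0 h1
  exact (h j i (by exact_mod_cast h0) (by exact_mod_cast h1)).symm

theorem restrictScalars_idealOfPoints_inf [Infinite k] (p q : Fin n → ℕ) (t : ℕ) :
    Submodule.restrictScalars k (idealOfPoints k (nodePoints k p q)) ⊓
      homogeneousSubmodule (Fin 3) k t = fatPointForms (nodes k p q) ∅ t := by
  ext f
  simp only [idealOfPoints, Submodule.mem_inf, Submodule.restrictScalars_mem, Submodule.mem_iInf,
    mem_homogeneousSubmodule, mem_fatPointForms, Finset.notMem_empty, false_imp_iff, implies_true,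
    and_true]
  rw [and_comm]
  exact and_congr_right fun hf => forall_congr' fun i => mem_pointIdeal_iff (node_two _ _) hf

theorem restrictScalars_doubleIdealOfPoints_inf [Infinite k] (p q : Fin n → ℕ) (t : ℕ) :
    Submodule.restrictScalars k (doubleIdealOfPoints k (nodePoints k p q)) ⊓
      homogeneousSubmodule (Fin 3) k t = fatPointForms (nodes k p q) Finset.univ t := by
  ext f
  simp only [doubleIdealOfPoints, Submodule.mem_inf, Submodule.restrictScalars_mem,
    Submodule.mem_iInf, mem_homogeneousSubmodule, mem_fatPointForms, Finset.mem_univ, true_imp_iff]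
  rw [and_comm]
  refine and_congr_right fun hf => ?_
  rw [and_iff_right_of_imp fun h i => (h i).1]
  exact forall_congr' fun i => mem_pointIdeal_sq_iff (node_two _ _) hf

end Nodes

section Configuration

variable {k : Type} [Field k] [CharZero k]

/-- The smaller parameters of the ten nodes of five tangent lines and of one further node on the
first of these lines. -/
def leftParam : Fin 11 → ℕ := ![0, 0, 0, 0, 1, 1, 1, 2, 2, 3, 0]

/-- The larger parameters of the nodes whose smaller parameters are given by `leftParam`. -/
def rightParam : Fin 11 → ℕ := ![1, 2, 3, 4, 2, 3, 4, 3, 4, 4, 5]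

theorem exists_param_eq : ∀ a ∈ Finset.range 5, ∀ b ∈ (Finset.range 5).erase a, ∃ i,
    leftParam i = a ∧ rightParam i = b ∨ leftParam i = b ∧ rightParam i = a := by
  decide

theorem card_range_five_erase : ∀ a ∈ Finset.range 5, ((Finset.range 5).erase a).card = 4 := by
  decide

theorem fatPointForms_empty_eq_bot {t : ℕ} (ht : t ≤ 3) :
    fatPointForms (nodes k leftParam rightParam) ∅ t = ⊥ := by
  refine (Submodule.eq_bot_iff _).mpr fun f hf => ?_
  obtain ⟨hf, h, -⟩ := mem_fatPointForms.mp hf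
  obtain ⟨-, -, -, h0⟩ := exists_eq_lineProd_mul (Finset.range 5) hf fun a ha =>
    restrictLine_eq_zero_of_eval_eq_zero (exists_param_eq a ha) hf
      (by rw [card_range_five_erase a ha]; omega) h
  exact h0 (by rw [Finset.card_range]; omega)

theorem finrank_fatPointForms_empty {t : ℕ} (ht : 4 ≤ t) :
    Module.finrank k (fatPointForms (nodes k leftParam rightParam) ∅ t) + 11 =
      (t + 2).choose 2 := by
  refine finrank_fatPointForms_nodes (fun i => Finset.range 6 \ {leftParam i, rightParam i})
    (fun _ => ∅) (by simp) (by decide) (by simp) (fun i => ?_) (by simp)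
  have : ∀ i, (Finset.range 6 \ {leftParam i, rightParam i}).card = 4 := by decide
  rw [this, Finset.card_empty]
  exact ht

theorem mem_fatPointForms_univ_iff {t : ℕ} (ht : t ≤ 7) {f : MvPolynomial (Fin 3) k} :
    f ∈ fatPointForms (nodes k leftParam rightParam) Finset.univ t ↔
      (t < 5 → f = 0) ∧
        ∃ g ∈ fatPointForms (nodes k (fun _ : Fin 1 => 0) fun _ => 5) ∅ (t - 5),
          lineProd k (Finset.range 5) * g = f := by
  have hsplit : lineProd k (Finset.range 5) =
      lineProd k ((Finset.range 5).erase 0) * tangentLine 0 := by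
    rw [lineProd, lineProd, ← Finset.prod_erase_mul _ _ (Finset.mem_range.mpr (Nat.succ_pos 4)),
      Nat.cast_zero]
  simp only [mem_fatPointForms, Finset.mem_univ, true_imp_iff, Finset.notMem_empty, false_imp_iff,
    implies_true, and_true]
  constructor
  · rintro ⟨hf, -, h⟩
    obtain ⟨g, hg, rfl, h0⟩ := exists_eq_lineProd_mul (Finset.range 5) hf fun a ha =>
      restrictLine_eq_zero_of_isSingularAt (exists_param_eq a ha) hf
        (by rw [card_range_five_erase a ha]; omega) h
    rw [Finset.card_range] at hg h0
    refine ⟨h0, g, ⟨hg, fun _ => ?_⟩, rfl⟩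
    have h10 := h 10
    rw [hsplit, mul_assoc] at h10
    have h10' := h10.of_mul_left (eval_lineProd_ne_zero (by decide) (by decide))
    simp only [nodes, leftParam, rightParam, Matrix.cons_val, Nat.cast_zero] at h10' ⊢
    exact eval_eq_zero_of_isSingularAt_tangentLine_mul h10'
  · rintro ⟨h0, g, ⟨hg, hQ⟩, rfl⟩
    have hsing (i : Fin 11) :
        IsSingularAt (nodes k leftParam rightParam i) (lineProd k (Finset.range 5) * g) := by
      by_cases hi : i = 10
      · subst hi
        exact isSingularAt_mul (eval_lineProd_eq_zero (by decide))
          (by simpa [nodes, leftParam, rightParam] using hQ 0)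
      have hr : ∀ i ≠ 10, leftParam i ∈ Finset.range 5 ∧
          rightParam i ∈ (Finset.range 5).erase (leftParam i) := by decide
      have hi' := hr i hi
      refine IsSingularAt.mul_right ?_ g
      rw [lineProd, ← Finset.mul_prod_erase _ _ hi'.1]
      exact isSingularAt_mul (by simp [nodes, eval_node_tangentLine])
        (eval_lineProd_eq_zero (Or.inr hi'.2))
    refine ⟨?_, fun i => (hsing i).1, hsing⟩
    rcases lt_or_ge t 5 with h | h
    · rw [h0 h]
      exact isHomogeneous_zero _ _ _
    · have := (isHomogeneous_lineProd (k := k) (Finset.range 5)).mul hg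
      rwa [Finset.card_range, Nat.add_sub_cancel' h] at this

theorem finrank_fatPointForms_univ_of_le_seven {t : ℕ} (h5 : 5 ≤ t) (h7 : t ≤ 7) :
    Module.finrank k (fatPointForms (nodes k leftParam rightParam) Finset.univ t) + 1 =
      (t - 3).choose 2 := by
  rw [finrank_eq_of_forall_mem_iff (V := fatPointForms (nodes k (fun _ : Fin 1 => 0) fun _ => 5)
    ∅ (t - 5)) (lineProd_ne_zero (Finset.range 5)) fun f => by
      rw [mem_fatPointForms_univ_iff h7, and_iff_right fun h => absurd h5 h.not_ge],
    show t - 3 = t - 5 + 2 by omega]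
  exact finrank_fatPointForms_nodes (fun _ => ∅) (fun _ => ∅) (by simp)
    (fun i j h => absurd (Subsingleton.elim j i) h) (by simp) (by simp) (by simp)

theorem finrank_fatPointForms_univ_eight :
    Module.finrank k (fatPointForms (nodes k leftParam rightParam) Finset.univ 8) = 13 := by
  set A : Finset (Fin 11) := {4, 5, 6, 7, 8, 9}
  have hA : ∀ i ∉ A, leftParam i = 0 := by decide
  rw [finrank_eq_of_forall_mem_iff (V := fatPointForms (nodes k leftParam rightParam) A 7)
    (tangentLine_ne_zero 0) fun f => ?_]
  · have := finrank_fatPointForms_nodes (k := k) (p := leftParam) (q := rightParam) (A := A) (t := 7)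
      (fun i => Finset.range 6 \ {leftParam i, rightParam i})
      (fun i => if i = 10 then {1, 2, 3} else {1, 2, 3, 4} \ {leftParam i, rightParam i})
      (by decide) (by decide) (by decide) (by decide) (by decide)
    simpa [A, Nat.choose] using this
  simp only [mem_fatPointForms, Finset.mem_univ, true_imp_iff]
  constructor
  · rintro ⟨hf, -, h⟩
    have hB : ∀ b ∈ ({1, 2, 3, 4, 5} : Finset ℕ), ∃ i,
      leftParam i = 0 ∧ rightParam i = b ∨ leftParam i = b ∧ rightParam i = 0 := by decide
    obtain ⟨g, hg, rfl, -⟩ := exists_eq_tangentLine_mul (a := 0) hf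
      (by simpa using restrictLine_eq_zero_of_isSingularAt hB hf (by decide) h)
    have hgA (i) (hi : i ∈ A) : IsSingularAt (nodes k leftParam rightParam i) g := by
      have h1 : ∀ i ∈ A, leftParam i ∉ ({0} : Finset ℕ) ∧ rightParam i ∉ ({0} : Finset ℕ) := by
        decide
      have h2 := eval_lineProd_ne_zero (k := k) (h1 i hi).1 (h1 i hi).2
      rw [lineProd, Finset.prod_singleton, Nat.cast_zero] at h2
      exact (h i).of_mul_left h2
    refine ⟨g, ⟨hg, fun i => ?_, hgA⟩, rfl⟩
    by_cases hi : i ∈ A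
    · exact (hgA i hi).1
    · have := h i
      rw [nodes, hA i hi, Nat.cast_zero] at this ⊢
      exact eval_eq_zero_of_isSingularAt_tangentLine_mul this
  · rintro ⟨g, ⟨hg, h0, h1⟩, rfl⟩
    have hsing (i : Fin 11) :
        IsSingularAt (nodes k leftParam rightParam i) (tangentLine 0 * g) := by
      by_cases hi : i ∈ A
      · exact (h1 i hi).mul_left _
      · refine isSingularAt_mul ?_ (h0 i)
        rw [nodes, hA i hi, eval_node_tangentLine]
        simp
    exact ⟨(isHomogeneous_tangentLine 0).mul hg, fun i => (hsing i).1, hsing⟩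

theorem finrank_fatPointForms_univ {t : ℕ} (ht : 9 ≤ t) :
    Module.finrank k (fatPointForms (nodes k leftParam rightParam) Finset.univ t) + 33 =
      (t + 2).choose 2 := by
  have h4 : ∀ i, (Finset.range 6 \ {leftParam i, rightParam i}).card = 4 := by decide
  have := finrank_fatPointForms_nodes (k := k) (p := leftParam) (q := rightParam)
    (A := Finset.univ) (t := t)
    (fun i => Finset.range 6 \ {leftParam i, rightParam i})
    (fun i => Finset.range 6 \ {leftParam i, rightParam i})
    (by decide) (by decide) (by decide) (fun i => by rw [h4]; omega) (fun i _ => by rw [h4]; omega)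
  simpa using this

end Configuration

/-- There exists a set of 11 distinct points of ℙ² with generic Hilbert
function whose double point scheme has Hilbert function exactly
m(t) = binom(t+2,2) for t ≤ 5, m(6) = 26, m(7) = 31, m(8) = 32, m(t) = 33 for t ≥ 9
(such a set is given by the configuration C_{5,1}). -/
theorem statement1 (k : Type) [Field k] [IsAlgClosed k] [CharZero k] :
    ∃ P : Fin 11 → Projectivization k (Fin 3 → k),
      Function.Injective P ∧ HasGenericHilbertFunction k P ∧
      ∀ t : ℕ,
        hilbertFunction k (doubleIdealOfPoints k P) t =
          (if t ≤ 5 then Nat.choose (t + 2) 2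
            else if t = 6 then 26
            else if t = 7 then 31
            else if t = 8 then 32
            else 33) := by
  refine ⟨nodePoints k leftParam rightParam, nodePoints_injective (by decide), fun t => ?_,
    fun t => ?_⟩
  · refine hilbertFunction_eq ?_
    rw [restrictScalars_idealOfPoints_inf]
    rcases le_or_gt t 3 with ht | ht
    · rw [fatPointForms_empty_eq_bot ht, finrank_bot]
      interval_cases t <;> decide
    · rw [min_eq_left, finrank_fatPointForms_empty ht]
      exact le_trans (by decide) (Nat.choose_le_choose 2 (show 6 ≤ t + 2 by omega))
  · refine hilbertFunction_eq ?_
    rw [restrictScalars_doubleIdealOfPoints_inf]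
    rcases lt_or_ge t 5 with h5 | h5
    · rw [(Submodule.eq_bot_iff _).mpr fun f hf =>
        ((mem_fatPointForms_univ_iff (by omega)).mp hf).1 h5, finrank_bot, if_pos h5.le, zero_add]
    rcases le_or_gt t 7 with h7 | h7
    · have := finrank_fatPointForms_univ_of_le_seven (k := k) h5 h7
      interval_cases t <;> simp [Nat.choose] at this ⊢ <;> omega
    rcases eq_or_lt_of_le (Nat.succ_le_of_lt h7) with rfl | h8
    · rw [finrank_fatPointForms_univ_eight]
      decide
    · rw [if_neg (by omega), if_neg (by omega), if_neg (by omega), if_neg (by omega),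
        finrank_fatPointForms_univ h8]
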